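/- arXiv:1503.08487 — 2 statements merged into one kernel-verified Lean document; each statement's English description precedes it below -/
import Mathlib

section
/- Let p be a prime and let G be a finite p-group such that the trivial subgroup {1} and G itself are the only normal subgroups of G that are comparable (with respect to inclusion) to every other normal subgroup of G. Then the following are equivalent: (1) the clone Comp(G) of congruence preserving functions of G is NOT finitely generated; (2) G is not cyclic and there exist normal subgroups E, D of G with E ≠ {1}, D ≠ G, such that every normal subgroup I of G satisfies I ≥ E or I ≤ D. -/
/-- A finitary operation on `A`. -/
abbrev FinOp (A : Type*) := Σ n : ℕ, (Fin n → A) → A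

/-- Membership in the clone generated by a set `F` of finitary operations:
the smallest set of finitary operations containing `F` and all projections
and closed under composition. -/
inductive InClone {A : Type*} (F : Set (FinOp A)) : {n : ℕ} → ((Fin n → A) → A) → Prop
  | proj {n : ℕ} (i : Fin n) : InClone F fun x => x i
  | base {n : ℕ} (f : (Fin n → A) → A) : (⟨n, f⟩ : FinOp A) ∈ F → InClone F f
  | comp {n m : ℕ} (f : (Fin m → A) → A) (g : Fin m → (Fin n → A) → A) :
      InClone F f → (∀ i, InClone F (g i)) → InClone F fun x => f fun i => g i x

/-- A function `G^k → G` is compatible (congruence preserving): it preserves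
every congruence, i.e. for every normal subgroup `N` and tuples `a ≡ b mod N`
one has `f a ≡ f b mod N`. -/
def Compatible {G : Type*} [Group G] {k : ℕ} (f : (Fin k → G) → G) : Prop :=
  ∀ N : Subgroup G, N.Normal → ∀ a b : Fin k → G,
    (∀ i, (a i)⁻¹ * b i ∈ N) → (f a)⁻¹ * f b ∈ N

/-- The clone `Comp G` of congruence preserving functions of `G` is finitely
generated: some finite set of compatible functions generates, as a clone,
exactly the compatible functions (of all arities `≥ 1`). -/
def CompFG (G : Type*) [Group G] : Prop :=
  ∃ F : Set (FinOp G), F.Finite ∧ (∀ f ∈ F, 1 ≤ f.1 ∧ Compatible f.2) ∧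
    ∀ (n : ℕ), 1 ≤ n → ∀ f : (Fin n → G) → G, (Compatible f ↔ InClone F f)

/-- A chief factor of index `p`: `A ≤ B` are normal subgroups and `B / A` has order `p`. -/
structure NormalStep {G : Type*} [Group G] (p : ℕ) (A B : Subgroup G) : Prop where
  normal_left : A.Normal
  normal_right : B.Normal
  le : A ≤ B
  relIndex : A.relIndex B = p

section NormalSteps

variable {G : Type*} [Group G] {p : ℕ}

lemma NormalStep.lt {A B : Subgroup G} (hp : p.Prime) (h : NormalStep p A B) : A < B := by
  refine lt_of_le_of_ne h.le fun hAB => ?_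
  have := h.relIndex
  rw [hAB, Subgroup.relIndex_self] at this
  exact hp.one_lt.ne this

lemma NormalStep.eq_of_lt {A B C : Subgroup G} (hp : p.Prime) (h : NormalStep p A B)
    (hAC : A < C) (hCB : C ≤ B) : C = B := by
  have hmul := Subgroup.relIndex_mul_relIndex A C B hAC.le hCB
  rw [h.relIndex] at hmul
  rcases hp.eq_one_or_self_of_dvd _ ⟨_, hmul.symm⟩ with h1 | h1
  · exact absurd (Subgroup.relIndex_eq_one.mp h1) hAC.not_ge
  · rw [h1] at hmul
    exact le_antisymm hCB (Subgroup.relIndex_eq_one.mp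
      (Nat.eq_of_mul_eq_mul_left hp.pos (hmul.trans (mul_one p).symm)))

/-- A nontrivial normal subgroup of a finite `p`-group contains a central element of order `p`. -/
lemma IsPGroup.exists_central_orderOf_eq [Finite G] (hp : p.Prime) (hG : IsPGroup p G)
    (N : Subgroup G) [N.Normal] (hN : N ≠ ⊥) :
    ∃ z ∈ N, z ∈ Subgroup.center G ∧ orderOf z = p := by
  have : Fact p.Prime := ⟨hp⟩
  have hdvd : p ∣ Nat.card N := by
    rcases (hG.to_subgroup N).card_eq_or_dvd with h | h
    · exact absurd (Subgroup.card_eq_one.mp h) hN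
    · exact h
  have hact := hG.of_equiv ConjAct.toConjAct
  obtain ⟨b, hb, hb1⟩ := hact.exists_fixed_point_of_prime_dvd_card_of_fixed_point
    N hdvd (a := 1) (fun g => smul_one g)
  have hbc : (b : G) ∈ Subgroup.center G := by
    rw [Subgroup.mem_center_iff]
    intro g
    have := congrArg Subtype.val (hb (ConjAct.toConjAct g))
    rw [ConjAct.Subgroup.val_conj_smul, ConjAct.toConjAct_smul] at this
    exact mul_inv_eq_iff_eq_mul.mp this
  have hb1' : (b : G) ≠ 1 := fun h => hb1 (Subtype.ext h.symm)
  obtain ⟨k, hk⟩ := hG.dvd_orderOf hb1'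
  have hk0 : k ≠ 0 := by
    rintro rfl
    exact (orderOf_pos (b : G)).ne' (by simpa using hk)
  refine ⟨(b : G) ^ k, N.pow_mem b.2 k, Subgroup.pow_mem _ hbc k, ?_⟩
  rw [orderOf_pow_of_dvd hk0 ⟨p, by rw [hk, mul_comm]⟩, hk]
  exact Nat.mul_div_cancel _ (Nat.pos_of_ne_zero hk0)

lemma IsPGroup.exists_normalStep_central [Finite G] (hp : p.Prime) (hG : IsPGroup p G)
    {A M : Subgroup G} (hA : A.Normal) (hM : M.Normal) (hAM : A < M) :
    ∃ B ≤ M, NormalStep p A B ∧ ∀ g, ∀ x ∈ B, g * x * g⁻¹ * x⁻¹ ∈ A := by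
  have hMN : (M.map (QuotientGroup.mk' A)).Normal :=
    hM.map _ (QuotientGroup.mk'_surjective A)
  have hne : M.map (QuotientGroup.mk' A) ≠ ⊥ := fun h => by
    rw [Subgroup.map_eq_bot_iff, QuotientGroup.ker_mk'] at h
    exact hAM.not_ge h
  obtain ⟨z, hzM, hzc, hz⟩ := (hG.to_quotient A).exists_central_orderOf_eq hp _ hne
  have hzle : Subgroup.zpowers z ≤ Subgroup.center (G ⧸ A) := by simpa using hzc
  have hzn : (Subgroup.zpowers z).Normal :=
    ⟨fun n hn g => by
      rw [← Subgroup.mem_center_iff.mp (hzle hn) g |>.symm, mul_inv_cancel_right]; exact hn⟩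
  refine ⟨(Subgroup.zpowers z).comap (QuotientGroup.mk' A), ?_, ⟨hA, hzn.comap _, ?_, ?_⟩, ?_⟩
  · intro x hx
    have : QuotientGroup.mk' A x ∈ M.map (QuotientGroup.mk' A) :=
      (Subgroup.zpowers_le.mpr hzM) hx
    obtain ⟨y, hy, hyx⟩ := this
    have := QuotientGroup.eq.mp hyx
    simpa using M.mul_mem hy (hAM.le this)
  · intro x hx
    have : QuotientGroup.mk' A x = 1 := (QuotientGroup.eq_one_iff x).mpr hx
    simp [Subgroup.mem_comap, this]
  · have h1 : A = (⊥ : Subgroup (G ⧸ A)).comap (QuotientGroup.mk' A) := by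
      rw [MonoidHom.comap_bot, QuotientGroup.ker_mk']
    conv_lhs => arg 1; rw [h1]
    rw [Subgroup.relIndex_comap,
      Subgroup.map_comap_eq_self_of_surjective (QuotientGroup.mk'_surjective A),
      Subgroup.relIndex_bot_left, Nat.card_zpowers, hz]
  · intro g x hx
    have := Subgroup.mem_center_iff.mp (hzle hx) (g : G ⧸ A)
    rw [← QuotientGroup.eq_one_iff]
    change (g : G ⧸ A) * (x : G ⧸ A) * (g : G ⧸ A)⁻¹ * (x : G ⧸ A)⁻¹ = 1
    rw [show (g : G ⧸ A) * (x : G ⧸ A) = x * g from this]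
    group

lemma IsPGroup.exists_normalStep_below [Finite G] (hp : p.Prime) (hG : IsPGroup p G)
    {Q B : Subgroup G} (hQ : Q.Normal) (hB : B.Normal) (hQB : Q < B) :
    ∃ A, Q ≤ A ∧ NormalStep p A B := by
  obtain ⟨A, hA⟩ := Set.Finite.exists_maximal
    (s := {A : Subgroup G | A.Normal ∧ Q ≤ A ∧ A < B}) (Set.toFinite _) ⟨Q, hQ, le_rfl, hQB⟩
  obtain ⟨hAn, hQA, hAB⟩ := hA.prop
  obtain ⟨C, hCB, hC, -⟩ := hG.exists_normalStep_central hp hAn hB hAB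
  rcases hCB.eq_or_lt with h | h
  · exact ⟨A, hQA, h ▸ hC⟩
  · exact absurd (hA.le_of_ge ⟨hC.normal_right, hQA.trans hC.le, h⟩ hC.le) (hC.lt hp).not_ge

/-- A central factor of order `p` carries a conjugation invariant character with kernel `A`. -/
lemma NormalStep.exists_char [Finite G] (hp : p.Prime) (hG : IsPGroup p G) {A B : Subgroup G}
    (h : NormalStep p A B) :
    ∃ χ : G → ZMod p, (∀ x ∈ B, ∀ y ∈ B, χ (x * y) = χ x + χ y) ∧
      (∀ x ∈ B, χ x = 0 ↔ x ∈ A) ∧ ∀ g, ∀ x ∈ B, χ (g * x * g⁻¹) = χ x := by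
  classical
  have : Fact p.Prime := ⟨hp⟩
  have := h.normal_left
  have hcentral : ∀ g, ∀ x ∈ B, g * x * g⁻¹ * x⁻¹ ∈ A := by
    obtain ⟨C, hCB, hC, hcen⟩ :=
      hG.exists_normalStep_central hp h.normal_left h.normal_right (h.lt hp)
    rwa [h.eq_of_lt hp (hC.lt hp) hCB] at hcen
  have hcard : Nat.card (B ⧸ A.subgroupOf B) = p := h.relIndex
  let e : (B ⧸ A.subgroupOf B) ≃* Multiplicative (ZMod p) :=
    mulEquivOfPrimeCardEq (p := p) hcard (by simp)
  let χ : G → ZMod p := fun x =>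
    if hx : x ∈ B then (e (QuotientGroup.mk ⟨x, hx⟩)).toAdd else 0
  have hadd : ∀ x ∈ B, ∀ y ∈ B, χ (x * y) = χ x + χ y := by
    intro x hx y hy
    simp only [χ, hx, hy, B.mul_mem hx hy, dif_pos]
    rw [← toAdd_mul, ← map_mul]
    rfl
  have hker : ∀ x ∈ B, χ x = 0 ↔ x ∈ A := by
    intro x hx
    simp only [χ, hx, dif_pos]
    rw [toAdd_eq_zero, EmbeddingLike.map_eq_one_iff, QuotientGroup.eq_one_iff,
      Subgroup.mem_subgroupOf]
  refine ⟨χ, hadd, hker, fun g x hx => ?_⟩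
  have h1 := hcentral g x hx
  have h2 := hadd _ (h.le h1) x hx
  rwa [inv_mul_cancel_right, (hker _ (h.le h1)).mpr h1, zero_add] at h2

lemma apply_pow_of_additive {B : Subgroup G} {χ : G → ZMod p}
    (hχ : ∀ x ∈ B, ∀ y ∈ B, χ (x * y) = χ x + χ y) {x : G} (hx : x ∈ B) (n : ℕ) :
    χ (x ^ n) = n * χ x := by
  induction n with
  | zero =>
    have := hχ 1 B.one_mem 1 B.one_mem
    rw [one_mul] at this
    simpa using this
  | succ n ih =>
    rw [pow_succ, hχ _ (B.pow_mem hx n) _ hx, ih]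
    push_cast
    ring

lemma exists_mem_apply_eq (hp : p.Prime) {A B : Subgroup G} (hAB : A ≤ B) {χ : G → ZMod p}
    (hχ : ∀ x ∈ B, ∀ y ∈ B, χ (x * y) = χ x + χ y) {a : G} (ha : a ∈ A) (h0 : χ a ≠ 0)
    (t : ZMod p) : ∃ x ∈ A, χ x = t := by
  have : Fact p.Prime := ⟨hp⟩
  refine ⟨a ^ (t / χ a).val, A.pow_mem ha _, ?_⟩
  rw [apply_pow_of_additive hχ (hAB ha), ZMod.natCast_zmod_val, div_mul_cancel₀ _ h0]

/-- Two distinct lower covers in a `p`-group have a third one, the diagonal. -/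
lemma NormalStep.exists_diagonal [Finite G] (hp : p.Prime) (hG : IsPGroup p G)
    {A₁ A₂ B : Subgroup G} (h₁ : NormalStep p A₁ B) (h₂ : NormalStep p A₂ B) (hne : A₁ ≠ A₂) :
    ∃ C : Subgroup G, C.Normal ∧ C ≤ B ∧ A₂ ⊓ C ≤ A₁ ∧ B ≤ A₁ ⊔ C ∧ B ≤ A₁ ⊔ A₂ := by
  have : Fact p.Prime := ⟨hp⟩
  obtain ⟨χ, hχ, hker, hconj⟩ := h₁.exists_char hp hG
  obtain ⟨ψ, hψ, hkerψ, hconjψ⟩ := h₂.exists_char hp hG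
  have hBn := h₁.normal_right
  let C : Subgroup G :=
    { carrier := {x | x ∈ B ∧ χ x = ψ x}
      one_mem' := ⟨B.one_mem, by
        rw [(hker 1 B.one_mem).mpr A₁.one_mem, (hkerψ 1 B.one_mem).mpr A₂.one_mem]⟩
      mul_mem' := fun {x y} hx hy => ⟨B.mul_mem hx.1 hy.1, by
        rw [hχ x hx.1 y hy.1, hψ x hx.1 y hy.1, hx.2, hy.2]⟩
      inv_mem' := fun {x} hx => ⟨B.inv_mem hx.1, by
        have e₁ := hχ x hx.1 x⁻¹ (B.inv_mem hx.1)
        have e₂ := hψ x hx.1 x⁻¹ (B.inv_mem hx.1)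
        rw [mul_inv_cancel, (hker 1 B.one_mem).mpr A₁.one_mem] at e₁
        rw [mul_inv_cancel, (hkerψ 1 B.one_mem).mpr A₂.one_mem, ← hx.2] at e₂
        exact add_left_cancel (e₁.symm.trans e₂)⟩ }
  have hnle : ¬ A₁ ≤ A₂ := fun hle =>
    (h₂.lt hp).ne (h₁.eq_of_lt hp (lt_of_le_of_ne hle hne) h₂.le)
  obtain ⟨a, ha, ha₂⟩ := Set.not_subset.mp hnle
  have ha0 : ψ a ≠ 0 := fun h => ha₂ ((hkerψ a (h₁.le ha)).mp h)
  refine ⟨C, ⟨fun x hx g => ⟨hBn.conj_mem x hx.1 g, ?_⟩⟩, fun x hx => hx.1, ?_, ?_, ?_⟩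
  · rw [hconj g x hx.1, hconjψ g x hx.1, hx.2]
  · rintro x ⟨hx₂, hxB, hx⟩
    exact (hker x hxB).mp (hx.trans ((hkerψ x hxB).mpr hx₂))
  · intro x hx
    obtain ⟨y, hy, hyt⟩ := exists_mem_apply_eq hp h₁.le hψ ha ha0 (χ x - ψ x)
    have hyB := h₁.le hy
    have hxC : y * x ∈ C := ⟨B.mul_mem hyB hx, by
      rw [hχ y hyB x hx, hψ y hyB x hx, hyt, (hker y hyB).mpr hy]; ring⟩
    have := mul_mem (Subgroup.mem_sup_left (inv_mem hy) : y⁻¹ ∈ A₁ ⊔ C)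
      (Subgroup.mem_sup_right hxC)
    rwa [inv_mul_cancel_left] at this
  · refine (h₂.eq_of_lt hp (lt_of_le_of_ne le_sup_right fun h => ?_) (sup_le h₁.le h₂.le)).ge
    exact hnle (h.symm ▸ le_sup_left)

end NormalSteps

section CentralFactors

variable {G : Type*} [Group G]

lemma Compatible.mk_eq {k : ℕ} {f : (Fin k → G) → G} (hf : Compatible f) {N : Subgroup G}
    (hN : N.Normal) {a b : Fin k → G} (h : ∀ i, (a i : G ⧸ N) = b i) :
    (f a : G ⧸ N) = f b :=
  QuotientGroup.eq.mpr (hf N hN a b fun i => QuotientGroup.eq.mp (h i))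

/-- The factor `B / A` is central with respect to all compatible functions: modulo `A`, the change
of a compatible function under a perturbation `y` from `B` does not depend on the base point. -/
def CentralFactor (A B : Subgroup G) : Prop :=
  ∀ ⦃k : ℕ⦄ (f : (Fin k → G) → G), Compatible f → ∀ x y : Fin k → G, (∀ i, y i ∈ B) →
    (f x)⁻¹ * f (x * y) * ((f 1)⁻¹ * f y)⁻¹ ∈ A

lemma mk_perturb_eq_of_mk_eq {k : ℕ} {f : (Fin k → G) → G} (hf : Compatible f) {N : Subgroup G}
    (hN : N.Normal) {x x' y y' : Fin k → G} (hx : ∀ i, (x i : G ⧸ N) = x' i)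
    (hy : ∀ i, (y i : G ⧸ N) = y' i) :
    (((f x)⁻¹ * f (x * y) * ((f 1)⁻¹ * f y)⁻¹ : G) : G ⧸ N) =
      ((f x')⁻¹ * f (x' * y') * ((f 1)⁻¹ * f y')⁻¹ : G) := by
  have hxy : ∀ i, ((x * y) i : G ⧸ N) = (x' * y') i := fun i => by
    simp only [Pi.mul_apply, QuotientGroup.mk_mul, hx i, hy i]
  simp only [QuotientGroup.mk_mul, QuotientGroup.mk_inv, hf.mk_eq hN hx, hf.mk_eq hN hy,
    hf.mk_eq hN hxy]

lemma perturb_mem_iff_of_mk_eq {k : ℕ} {f : (Fin k → G) → G} (hf : Compatible f) {N : Subgroup G}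
    (hN : N.Normal) {x x' y y' : Fin k → G} (hx : ∀ i, (x i : G ⧸ N) = x' i)
    (hy : ∀ i, (y i : G ⧸ N) = y' i) :
    (f x)⁻¹ * f (x * y) * ((f 1)⁻¹ * f y)⁻¹ ∈ N ↔
      (f x')⁻¹ * f (x' * y') * ((f 1)⁻¹ * f y')⁻¹ ∈ N := by
  rw [← QuotientGroup.eq_one_iff, mk_perturb_eq_of_mk_eq hf hN hx hy, QuotientGroup.eq_one_iff]

lemma perturb_mem_left {k : ℕ} {f : (Fin k → G) → G} (hf : Compatible f) {N : Subgroup G}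
    (hN : N.Normal) {x y : Fin k → G} (hx : ∀ i, x i ∈ N) :
    (f x)⁻¹ * f (x * y) * ((f 1)⁻¹ * f y)⁻¹ ∈ N := by
  refine (perturb_mem_iff_of_mk_eq hf hN (x' := 1) (y' := y)
    (fun i => (QuotientGroup.eq_one_iff _).mpr (hx i)) fun _ => rfl).mpr ?_
  simp [N.one_mem]

lemma perturb_mem_right {k : ℕ} {f : (Fin k → G) → G} (hf : Compatible f) {N : Subgroup G}
    (hN : N.Normal) {x y : Fin k → G} (hy : ∀ i, y i ∈ N) :
    (f x)⁻¹ * f (x * y) * ((f 1)⁻¹ * f y)⁻¹ ∈ N := by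
  refine (perturb_mem_iff_of_mk_eq hf hN (x' := x) (y' := 1) (fun _ => rfl)
    (fun i => (QuotientGroup.eq_one_iff _).mpr (hy i))).mpr ?_
  simp [N.one_mem]

lemma exists_pi_mk_eq {k : ℕ} {N C B : Subgroup G} (hN : N.Normal) (hB : B ≤ N ⊔ C)
    (y : Fin k → G) (hy : ∀ i, y i ∈ B) :
    ∃ c : Fin k → G, (∀ i, c i ∈ C) ∧ ∀ i, (y i : G ⧸ N) = c i := by
  have h : ∀ i, ∃ c ∈ C, (y i : G ⧸ N) = c := fun i => by
    obtain ⟨n, hn, c, hc, hnc⟩ := Subgroup.mem_sup_of_normal_left.mp (hB (hy i))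
    refine ⟨c, hc, ?_⟩
    rw [← hnc, QuotientGroup.mk_mul, (QuotientGroup.eq_one_iff n).mpr hn, one_mul]
  choose c hc hyc using h
  exact ⟨c, hc, hyc⟩

lemma CentralFactor.up {A B A' B' : Subgroup G} (h : CentralFactor A B) (hA' : A'.Normal)
    (hA : A ≤ A') (hB : B' ≤ A' ⊔ B) : CentralFactor A' B' := by
  intro k f hf x y hy
  obtain ⟨b, hb, hyb⟩ := exists_pi_mk_eq hA' hB y hy
  exact (perturb_mem_iff_of_mk_eq hf hA' (fun _ => rfl) hyb).mpr (hA (h f hf x b hb))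

lemma CentralFactor.down {A B A' B' : Subgroup G} (h : CentralFactor A' B') (hBn : B.Normal)
    (hB : B ≤ B') (hA : A' ⊓ B ≤ A) : CentralFactor A B := fun _ f hf x y hy =>
  hA ⟨h f hf x y fun i => hB (hy i), perturb_mem_right hf hBn hy⟩

lemma centralFactor_top {A B C : Subgroup G} (hA : A.Normal) (hB : B.Normal) (hC : C.Normal)
    (hAB : ⊤ ≤ A ⊔ B) (hAC : ⊤ ≤ A ⊔ C) (hBC : B ⊓ C ≤ A) : CentralFactor A ⊤ := by
  intro k f hf x y _
  obtain ⟨b, hb, hxb⟩ := exists_pi_mk_eq hA hAB x fun _ => Subgroup.mem_top _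
  obtain ⟨c, hc, hyc⟩ := exists_pi_mk_eq hA hAC y fun _ => Subgroup.mem_top _
  exact (perturb_mem_iff_of_mk_eq hf hA hxb hyc).mpr
    (hBC ⟨perturb_mem_left hf hB hb, perturb_mem_right hf hC hc⟩)

variable {p : ℕ} [Finite G]

lemma CentralFactor.of_common_cover (hp : p.Prime) (hG : IsPGroup p G) {A A' B : Subgroup G}
    (h : NormalStep p A B) (h' : NormalStep p A' B) (hc : CentralFactor A' B) :
    CentralFactor A B := by
  by_cases hne : A = A'
  · exact hne ▸ hc
  obtain ⟨C, hC, hCB, hinf, hsup, -⟩ := h.exists_diagonal hp hG h' hne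
  exact (hc.down hC hCB le_rfl).up h.normal_left hinf hsup

/-- In a noncyclic `p`-group whose normal subgroup lattice has no proper cut points, all chief
factors are central with respect to the compatible functions. -/
lemma NormalStep.centralFactor (hp : p.Prime) (hG : IsPGroup p G) (hcyc : ¬ IsCyclic G)
    (honly : ∀ N : Subgroup G, N.Normal →
      (∀ M : Subgroup G, M.Normal → M ≤ N ∨ N ≤ M) → N = ⊥ ∨ N = ⊤)
    {A B : Subgroup G} (h : NormalStep p A B) : CentralFactor A B := by
  have : Fact p.Prime := ⟨hp⟩
  induction B using WellFoundedGT.induction generalizing A with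
  | ind B ih =>
  have hAn := h.normal_left
  have hBn := h.normal_right
  rcases eq_or_ne B ⊤ with rfl | hBtop
  · have hAbot : A ≠ ⊥ := by
      rintro rfl
      have := h.relIndex
      rw [Subgroup.relIndex_bot_left, Subgroup.card_top] at this
      exact hcyc (isCyclic_of_prime_card this)
    have hcut : ¬ ∀ M : Subgroup G, M.Normal → M ≤ A ∨ A ≤ M := fun hM =>
      (honly A hAn hM).elim hAbot (h.lt hp).ne
    push Not at hcut
    obtain ⟨M, hM, hMA, hAM⟩ := hcut
    have hMtop : M < ⊤ := lt_top_iff_ne_top.mpr fun h => hAM (h ▸ le_top)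
    obtain ⟨A₂, hMA₂, h₂⟩ := hG.exists_normalStep_below hp hM hBn hMtop
    have hne : A ≠ A₂ := fun h => hMA (h ▸ hMA₂)
    obtain ⟨C, hC, -, hinf, hsup, hsup₂⟩ := h.exists_diagonal hp hG h₂ hne
    exact centralFactor_top hAn h₂.normal_left hC hsup₂ hsup hinf
  · have hBbot : B ≠ ⊥ := fun hB => not_lt_bot (hB ▸ h.lt hp)
    have hcut : ¬ ∀ M : Subgroup G, M.Normal → M ≤ B ∨ B ≤ M := fun hM =>
      (honly B hBn hM).elim hBbot hBtop
    push Not at hcut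
    obtain ⟨M, hM, hMB, hBM⟩ := hcut
    have hinfM : B ⊓ M < M := lt_of_le_of_ne inf_le_right fun h => hMB (h ▸ inf_le_left)
    obtain ⟨b, hbM, hb, -⟩ := hG.exists_normalStep_central hp inferInstance hM hinfM
    have hbn := hb.normal_right
    have hBb : B ⊓ b = B ⊓ M :=
      le_antisymm (inf_le_inf_left B hbM) (le_inf inf_le_left hb.le)
    have hlt : B < B ⊔ b := by
      refine lt_of_le_of_ne le_sup_left fun h => (hb.lt hp).ne ?_
      rw [← hBb]
      exact inf_eq_right.mpr (h ▸ le_sup_right)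
    obtain ⟨A₂, hA₂, h₂⟩ := hG.exists_normalStep_below hp (inferInstance : (B ⊓ M).Normal) hBn
      (lt_of_le_of_ne inf_le_left fun h => hBM (inf_eq_left.mp h))
    have hA₂n := h₂.normal_left
    refine CentralFactor.of_common_cover hp hG h h₂ ?_
    have hinf : (A₂ ⊔ b) ⊓ B = A₂ := by
      refine le_antisymm ?_ (le_inf le_sup_left h₂.le)
      rintro x ⟨hx, hxB⟩
      obtain ⟨a, ha, c, hc, rfl⟩ := Subgroup.mem_sup_of_normal_left.mp hx
      have hcB : c ∈ B := (B.mul_mem_cancel_left (h₂.le ha)).mp hxB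
      exact A₂.mul_mem ha (hA₂ (hBb ▸ ⟨hcB, hc⟩))
    have hstep : NormalStep p (A₂ ⊔ b) (B ⊔ b) := by
      refine ⟨inferInstance, inferInstance, sup_le_sup_right h₂.le b, ?_⟩
      have hsup : B ⊔ b = B ⊔ (A₂ ⊔ b) := by rw [← sup_assoc, sup_eq_left.mpr h₂.le]
      rw [hsup, Subgroup.relIndex_sup_right, ← Subgroup.inf_relIndex_right, hinf, h₂.relIndex]
    exact (ih (B ⊔ b) hlt hstep).down hBn le_sup_left hinf.le

end CentralFactors

section PreservesNormal

variable {G : Type*} [Group G] {ι κ : Type*}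

/-- Compatibility of an operation with an arbitrary index set of arguments. -/
def PreservesNormal (f : (ι → G) → G) : Prop :=
  ∀ N : Subgroup G, N.Normal → ∀ a b : ι → G, (∀ i, (a i)⁻¹ * b i ∈ N) → (f a)⁻¹ * f b ∈ N

lemma compatible_iff_preservesNormal {k : ℕ} {f : (Fin k → G) → G} :
    Compatible f ↔ PreservesNormal f := Iff.rfl

lemma PreservesNormal.proj (i : ι) : PreservesNormal fun x : ι → G => x i :=
  fun _ _ _ _ h => h i

lemma PreservesNormal.const (c : G) : PreservesNormal fun _ : ι → G => c :=
  fun N _ _ _ _ => by simp [N.one_mem]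

lemma PreservesNormal.comp {f : (κ → G) → G} (hf : PreservesNormal f) {g : κ → (ι → G) → G}
    (hg : ∀ i, PreservesNormal (g i)) : PreservesNormal fun x => f fun i => g i x :=
  fun N hN a b h => hf N hN _ _ fun i => hg i N hN a b h

lemma PreservesNormal.mul {f g : (ι → G) → G} (hf : PreservesNormal f) (hg : PreservesNormal g) :
    PreservesNormal fun x => f x * g x := fun N hN a b h => by
  have h₁ := QuotientGroup.eq.mpr (hf N hN a b h)
  have h₂ := QuotientGroup.eq.mpr (hg N hN a b h)
  rw [← QuotientGroup.eq, QuotientGroup.mk_mul, QuotientGroup.mk_mul, h₁, h₂]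

lemma PreservesNormal.inv {f : (ι → G) → G} (hf : PreservesNormal f) :
    PreservesNormal fun x => (f x)⁻¹ := fun N hN a b h => by
  have h₁ := QuotientGroup.eq.mpr (hf N hN a b h)
  rw [← QuotientGroup.eq, QuotientGroup.mk_inv, QuotientGroup.mk_inv, h₁]

lemma PreservesNormal.update [DecidableEq ι] {f h : (ι → G) → G} (hf : PreservesNormal f)
    (hh : PreservesNormal h) (i : ι) :
    PreservesNormal fun x => f (Function.update x i (h x)) := by
  have hg : ∀ j, PreservesNormal fun x : ι → G => Function.update x i (h x) j := fun j => by
    rcases eq_or_ne j i with rfl | hj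
    · simpa using hh
    · simpa [hj] using PreservesNormal.proj j
  exact hf.comp hg

lemma InClone.preservesNormal {F : Set (FinOp G)} (hF : ∀ f ∈ F, Compatible f.2) {n : ℕ}
    {f : (Fin n → G) → G} (hf : InClone F f) : PreservesNormal f := by
  induction hf with
  | proj i => exact .proj i
  | base f h => exact hF _ h
  | comp f g _ _ ihf ihg => exact ihf.comp ihg

end PreservesNormal

section Absorbing

variable {G : Type*} [Group G]

/-- The values at arguments from `∏ N i` of the compatible functions that vanish as soon as one of
the arguments with index in `S` is trivial. -/
def absorbingValues (S : Finset ℕ) (N : ℕ → Subgroup G) : Set G :=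
  {v | ∃ f : (ℕ → G) → G, PreservesNormal f ∧ (∀ x, (∃ i ∈ S, x i = 1) → f x = 1) ∧
    ∃ x, (∀ i, x i ∈ N i) ∧ f x = v}

lemma absorbingValues_mono {S S' : Finset ℕ} {N N' : ℕ → Subgroup G} (hS : S ⊆ S')
    (hN : ∀ i, N' i ≤ N i) : absorbingValues S' N' ⊆ absorbingValues S N := by
  rintro v ⟨f, hf, habs, x, hx, rfl⟩
  exact ⟨f, hf, fun y ⟨i, hi, hy⟩ => habs y ⟨i, hS hi, hy⟩, x, fun i => hN i (hx i), rfl⟩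

lemma absorbingValues_subset {S : Finset ℕ} {N : ℕ → Subgroup G} {i : ℕ} (hi : i ∈ S)
    (hN : (N i).Normal) : absorbingValues S N ⊆ N i := by
  rintro v ⟨f, hf, habs, x, hx, rfl⟩
  have h := hf (N i) hN (Function.update x i 1) x fun j => by
    rcases eq_or_ne j i with rfl | hj
    · simpa using hx j
    · simp [hj, (N i).one_mem]
  rwa [habs _ ⟨i, hi, by simp⟩, inv_one, one_mul] at h

/-- The elements `d` that annihilate all compatible functions absorbing on a sufficiently large
index set, when substituted for the argument with index `i`. -/
def absorbingAnnihilator (N : ℕ → Subgroup G) (hN : {j | N j ≠ ⊤}.Finite) (i : ℕ) :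
    Subgroup G :=
  let P : Finset ℕ → G → Prop := fun S d => ∀ f : (ℕ → G) → G, PreservesNormal f →
    (∀ x, (∃ j ∈ S, x j = 1) → f x = 1) → ∀ x, (∀ j, x j ∈ N j) → f (Function.update x i d) = 1
  have key : ∀ S : Finset ℕ, i ∈ S → ∀ d e : G, P S d → ∀ f : (ℕ → G) → G, PreservesNormal f →
      (∀ x, (∃ j ∈ S, x j = 1) → f x = 1) → ∀ x, (∀ j, x j ∈ N j) →
      f (Function.update x i (d * e)) = f (Function.update x i e) := by
    intro S hiS d e hd f hf habs x hx
    obtain ⟨j, hj⟩ := (S.finite_toSet.union hN).exists_notMem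
    simp only [Set.mem_union, Finset.mem_coe, Set.mem_ofPred_eq, not_or, not_not] at hj
    have hij : i ≠ j := fun h => hj.1 (h ▸ hiS)
    have hpres : ∀ h : (ℕ → G) → G, PreservesNormal h →
        PreservesNormal fun y => f (Function.update (Function.update y j (x j)) i (h y)) :=
      fun h hh => by
        have hf' : PreservesNormal fun z : ℕ → G => f (Function.update z j (x j)) :=
          hf.update (.const (x j)) j
        have := hf'.update hh i
        simpa only [Function.update_comm hij] using this
    let g : (ℕ → G) → G := fun y =>
      (f (Function.update (Function.update y j (x j)) i (y i)))⁻¹ *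
        f (Function.update (Function.update y j (x j)) i (y i * y j)) *
        (f (Function.update (Function.update y j (x j)) i (y j)))⁻¹
    have hg : PreservesNormal g :=
      ((hpres _ (.proj i)).inv.mul (hpres _ ((PreservesNormal.proj i).mul (.proj j)))).mul
        (hpres _ (.proj j)).inv
    have hgabs : ∀ y, (∃ l ∈ S, y l = 1) → g y = 1 := by
      rintro y ⟨l, hl, hyl⟩
      have hlj : l ≠ j := fun h => hj.1 (h ▸ hl)
      rcases eq_or_ne l i with rfl | hli
      · have h1 : f (Function.update (Function.update y j (x j)) l 1) = 1 :=
          habs _ ⟨l, hl, by simp⟩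
        simp [g, hyl, h1]
      · have h1 : ∀ c, f (Function.update (Function.update y j (x j)) i c) = 1 := fun c =>
          habs _ ⟨l, hl, by simp [hli, hlj, hyl]⟩
        simp [g, h1]
    have hval := hd g hg hgabs (Function.update x j e) fun l => by
      rcases eq_or_ne l j with rfl | hl
      · simp [hj.2]
      · simpa [hl] using hx l
    have hcd := hd f hf habs x hx
    have hupd : ∀ c, Function.update (Function.update (Function.update (Function.update x j e) i d)
        j (x j)) i c = Function.update x i c := fun c => by
      funext l
      rcases eq_or_ne l i with rfl | hli
      · simp
      · rcases eq_or_ne l j with rfl | hlj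
        · simp [hli]
        · simp [hli, hlj]
    simp only [g, hupd, Function.update_self, Function.update_of_ne hij.symm, hcd, inv_one,
      one_mul] at hval
    exact mul_inv_eq_one.mp hval
  have mono : ∀ {S S' : Finset ℕ}, S ⊆ S' → ∀ d, P S d → P S' d := by
    intro S S' hS d hd f hf habs
    exact hd f hf fun x ⟨j, hj, hx⟩ => habs x ⟨j, hS hj, hx⟩
  { carrier := {d | ∃ S, i ∈ S ∧ P S d}
    one_mem' := ⟨{i}, by simp, fun f _ habs x _ => habs _ ⟨i, by simp⟩⟩
    mul_mem' := by
      rintro d e ⟨S, hS, hd⟩ ⟨S', -, he⟩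
      refine ⟨S ∪ S', Finset.mem_union_left _ hS, fun f hf habs x hx => ?_⟩
      rw [key (S ∪ S') (Finset.mem_union_left _ hS) d e
        (mono Finset.subset_union_left d hd) f hf habs x hx]
      exact mono Finset.subset_union_right e he f hf habs x hx
    inv_mem' := by
      rintro d ⟨S, hS, hd⟩
      refine ⟨S, hS, fun f hf habs x hx => ?_⟩
      rw [← key S hS d d⁻¹ hd f hf habs x hx, mul_inv_cancel]
      exact habs _ ⟨i, hS, by simp⟩ }

lemma mem_absorbingAnnihilator {N : ℕ → Subgroup G} {hN : {j | N j ≠ ⊤}.Finite} {i : ℕ} {d : G} :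
    d ∈ absorbingAnnihilator N hN i ↔ ∃ S : Finset ℕ, i ∈ S ∧ ∀ f : (ℕ → G) → G,
      PreservesNormal f → (∀ x, (∃ j ∈ S, x j = 1) → f x = 1) → ∀ x, (∀ j, x j ∈ N j) →
        f (Function.update x i d) = 1 := Iff.rfl

lemma absorbingAnnihilator_normal (N : ℕ → Subgroup G) (hN : {j | N j ≠ ⊤}.Finite) (i : ℕ) :
    (absorbingAnnihilator N hN i).Normal := by
  refine ⟨fun d ⟨S, hS, hd⟩ z => ⟨S, hS, fun f hf habs x hx => ?_⟩⟩
  have := hd (fun y => f (Function.update y i (z * y i * z⁻¹)))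
    (hf.update (((PreservesNormal.const z).mul (.proj i)).mul (.const z⁻¹)) i)
    (fun y ⟨j, hj, hy⟩ => habs _ ⟨j, hj, by
      rcases eq_or_ne j i with rfl | hji
      · simp [hy]
      · simp [hji, hy]⟩) x hx
  simpa using this

/-- If the normal subgroup lattice has no splitting pair, then compatible functions that are
absorbing in sufficiently many arguments are trivial. -/
theorem exists_finset_absorbingValues_trivial [Finite G]
    (hsplit : ¬ ∃ E D : Subgroup G, E.Normal ∧ D.Normal ∧ E ≠ ⊥ ∧ D ≠ ⊤ ∧
        ∀ I : Subgroup G, I.Normal → E ≤ I ∨ I ≤ D) :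
    ∃ S : Finset ℕ, ∀ v ∈ absorbingValues S (fun _ => (⊤ : Subgroup G)), v = 1 := by
  by_contra! hnontriv
  let P : Set (Set G) := {V | ∃ (S : Finset ℕ) (N : ℕ → Subgroup G), {j | N j ≠ ⊤}.Finite ∧
    (∀ S', ∃ v ∈ absorbingValues S' N, v ≠ 1) ∧ V = absorbingValues S N}
  obtain ⟨V, hV⟩ := P.toFinite.exists_minimal
    ⟨_, ∅, fun _ => ⊤, by simp, hnontriv, rfl⟩
  obtain ⟨S, N, hN, hne, hVS⟩ := hV.prop
  obtain ⟨i, hi⟩ := (S.finite_toSet.union hN).exists_notMem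
  simp only [Set.mem_union, Finset.mem_coe, Set.mem_ofPred_eq, not_or, not_not] at hi
  refine hsplit ⟨Subgroup.normalClosure V, absorbingAnnihilator N hN i, inferInstance,
    absorbingAnnihilator_normal N hN i, ?_, ?_, fun I hI => ?_⟩
  · intro h
    obtain ⟨v, hv, hv1⟩ := hne S
    rw [Subgroup.normalClosure_eq_bot_iff, hVS] at h
    exact hv1 (h hv)
  · intro htop
    have hmem : ∀ d : G, d ∈ absorbingAnnihilator N hN i := fun d => htop ▸ Subgroup.mem_top d
    choose T _ hT using fun d => mem_absorbingAnnihilator.mp (hmem d)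
    obtain ⟨U, hU⟩ := (Set.finite_range T).exists_le
    obtain ⟨v, ⟨f, hf, habs, x, hx, rfl⟩, hv1⟩ := hne U
    refine hv1 ?_
    have := hT (x i) f hf (fun y ⟨j, hj, hy⟩ => habs y ⟨j, hU _ ⟨x i, rfl⟩ hj, hy⟩) x hx
    rwa [Function.update_eq_self] at this
  · have hN'fin : {j | Function.update N i I j ≠ ⊤}.Finite :=
      (hN.insert i).subset fun j hj => by
        rcases eq_or_ne j i with rfl | hji
        · exact Set.mem_insert _ _
        · exact Set.mem_insert_of_mem _ (by simpa [hji] using hj)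
    have hN'le : ∀ j, Function.update N i I j ≤ N j := fun j => by
      rcases eq_or_ne j i with rfl | hji
      · simp [hi.2]
      · simp [hji]
    by_cases hI' : ∀ S', ∃ v ∈ absorbingValues S' (Function.update N i I), v ≠ 1
    · left
      have hle := hV.le_of_le (y := absorbingValues (insert i S) (Function.update N i I))
        ⟨_, _, hN'fin, hI', rfl⟩
        (hVS ▸ absorbingValues_mono (Finset.subset_insert i S) hN'le)
      refine Subgroup.normalClosure_le_normal (hle.trans ?_)
      have := absorbingValues_subset (N := Function.update N i I) (Finset.mem_insert_self i S)
        (by simpa using hI)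
      simpa using this
    · right
      push Not at hI'
      obtain ⟨S', hS'⟩ := hI'
      intro d hd
      refine mem_absorbingAnnihilator.mpr ⟨insert i S', Finset.mem_insert_self i S',
        fun f hf habs x hx => hS' _ ⟨f, hf, fun y ⟨j, hj, hy⟩ =>
          habs y ⟨j, Finset.mem_insert_of_mem hj, hy⟩, _, fun j => ?_, rfl⟩⟩
      rcases eq_or_ne j i with rfl | hji
      · simpa using hd
      · simpa [hji] using hx j

lemma exists_arity_absorbing_trivial [Finite G]
    (hsplit : ¬ ∃ E D : Subgroup G, E.Normal ∧ D.Normal ∧ E ≠ ⊥ ∧ D ≠ ⊤ ∧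
        ∀ I : Subgroup G, I.Normal → E ≤ I ∨ I ≤ D) :
    ∃ K : ℕ, ∀ k ≥ K, ∀ f : (Fin k → G) → G, Compatible f →
      (∀ x, (∃ i, x i = 1) → f x = 1) → ∀ x, f x = 1 := by
  obtain ⟨S, hS⟩ := exists_finset_absorbingValues_trivial hsplit
  obtain ⟨K, hK⟩ := S.exists_nat_subset_range
  refine ⟨K, fun k hk f hf habs x => hS _ ⟨fun y => f fun i => y i,
    (compatible_iff_preservesNormal.mp hf).comp fun i => .proj (i : ℕ), ?_,
    fun j => if h : j < k then x ⟨j, h⟩ else 1, fun _ => Subgroup.mem_top _, by simp⟩⟩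
  rintro y ⟨j, hj, hy⟩
  exact habs _ ⟨⟨j, (Finset.mem_range.mp (hK hj)).trans_le hk⟩, hy⟩

end Absorbing

lemma InClone.comp_two {A : Type*} {F : Set (FinOp A)} {n : ℕ} {t : (Fin 2 → A) → A}
    {g h : (Fin n → A) → A} (ht : InClone F t) (hg : InClone F g) (hh : InClone F h) :
    InClone F fun x => t ![g x, h x] := by
  have := InClone.comp t ![g, h] ht (by simp [Fin.forall_fin_two, hg, hh])
  convert this using 3 with x
  funext i
  fin_cases i <;> rfl

section FiniteGeneration

variable {G : Type*} [Group G]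

/-- The compatible operations of arity between `1` and `M`. -/
def smallCompatible (G : Type*) [Group G] (M : ℕ) : Set (FinOp G) :=
  {f | 1 ≤ f.1 ∧ f.1 ≤ M ∧ Compatible f.2}

lemma smallCompatible_finite [Finite G] (M : ℕ) : (smallCompatible G M).Finite := by
  refine ((Set.finite_Iic M).biUnion
    (t := fun n => Set.range fun f : (Fin n → G) → G => (⟨n, f⟩ : FinOp G))
    fun n _ => Set.finite_range _).subset ?_
  rintro ⟨n, f⟩ ⟨-, hn, -⟩
  exact Set.mem_biUnion (Set.mem_Iic.mpr hn) ⟨f, rfl⟩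

lemma compFG_of_smallCompatible [Finite G] (M : ℕ)
    (h : ∀ n, 1 ≤ n → ∀ f : (Fin n → G) → G, Compatible f → InClone (smallCompatible G M) f) :
    CompFG G :=
  ⟨smallCompatible G M, smallCompatible_finite M, fun _ hf => ⟨hf.1, hf.2.2⟩, fun n hn f =>
    ⟨h n hn f, fun hf => hf.preservesNormal fun _ hg => hg.2.2⟩⟩

lemma inClone_smallCompatible_of_le {M n : ℕ} (hn : 1 ≤ n) (hnM : n ≤ M) {f : (Fin n → G) → G}
    (hf : Compatible f) : InClone (smallCompatible G M) f :=
  .base f ⟨hn, hnM, hf⟩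

lemma InClone.mul_of_smallCompatible {M n : ℕ} (hM : 2 ≤ M) {g h : (Fin n → G) → G}
    (hg : InClone (smallCompatible G M) g) (hh : InClone (smallCompatible G M) h) :
    InClone (smallCompatible G M) fun x => g x * h x :=
  (inClone_smallCompatible_of_le one_le_two hM
    (f := fun z => z 0 * z 1) ((PreservesNormal.proj 0).mul (.proj 1))).comp_two hg hh

lemma inClone_const {M n : ℕ} (hM : 1 ≤ M) (hn : 1 ≤ n) (c : G) :
    InClone (smallCompatible G M) fun _ : Fin n → G => c :=
  .comp (fun _ : Fin 1 → G => c) (fun _ x => x ⟨0, hn⟩)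
    (inClone_smallCompatible_of_le le_rfl hM (PreservesNormal.const c)) fun _ => .proj _

lemma compFG_of_absorbing_trivial [Finite G] (K : ℕ)
    (hK : ∀ k ≥ K, ∀ f : (Fin k → G) → G, Compatible f →
      (∀ x, (∃ i, x i = 1) → f x = 1) → ∀ x, f x = 1) : CompFG G := by
  have hM : 2 ≤ max K 2 := le_max_right _ _
  refine compFG_of_smallCompatible (max K 2) fun n hn => ?_
  induction n, hn using Nat.le_induction with
  | base => exact fun f hf => inClone_smallCompatible_of_le le_rfl (one_le_two.trans hM) hf
  | succ n hn ih =>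
    rcases le_or_gt (n + 1) (max K 2) with hle | hgt
    · exact fun f hf => inClone_smallCompatible_of_le (by omega) hle hf
    have main : ∀ j ≤ n + 1, ∀ f : (Fin (n + 1) → G) → G, Compatible f →
        (∀ x, (∃ i : Fin (n + 1), (i : ℕ) < j ∧ x i = 1) → f x = 1) →
        InClone (smallCompatible G (max K 2)) f := by
      intro j hj
      induction hj using Nat.decreasingInduction with
      | self =>
        intro f hf habs
        have hf1 : f = fun _ => 1 := funext <| hK (n + 1) ((le_max_left K 2).trans hgt.le) f hf
          fun x ⟨i, hi⟩ => habs x ⟨i, i.2, hi⟩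
        rw [hf1]
        exact inClone_const (one_le_two.trans hM) (by omega) 1
      | of_succ j hj ihj =>
        intro f hf habs
        let a : Fin (n + 1) := ⟨j, hj⟩
        have hf₁ : Compatible fun x => f (Function.update x a 1) :=
          PreservesNormal.update hf (.const 1) a
        have h₁ : InClone (smallCompatible G (max K 2)) fun x => f (Function.update x a 1) := by
          have hc : Compatible fun y : Fin n → G => f (Fin.insertNth a 1 y) := by
            refine PreservesNormal.comp (g := fun i (y : Fin n → G) =>
              (Fin.insertNth a 1 y : Fin (n + 1) → G) i) hf fun i => ?_
            refine Fin.succAboveCases a ?_ (fun l => ?_) i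
            · simpa using PreservesNormal.const 1
            · simpa using PreservesNormal.proj l
          have := InClone.comp _ (fun (i : Fin n) (x : Fin (n + 1) → G) => x (a.succAbove i))
            (ih _ hc) fun i => .proj _
          convert this using 3 with x
          funext i
          refine Fin.succAboveCases a ?_ (fun l => ?_) i
          · simp
          · simp [Fin.succAbove_ne]
        have h₂ : InClone (smallCompatible G (max K 2))
            fun x => f x * (f (Function.update x a 1))⁻¹ := by
          refine ihj _ (PreservesNormal.mul hf (PreservesNormal.inv hf₁)) ?_
          rintro x ⟨i, hi, hx⟩
          rcases eq_or_ne i a with rfl | hia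
          · rw [← hx, Function.update_eq_self, mul_inv_cancel, hx]
          · have hij : (i : ℕ) < j :=
              lt_of_le_of_ne (Nat.lt_succ_iff.mp hi) fun h => hia (Fin.ext h)
            rw [habs x ⟨i, hij, hx⟩, habs _ ⟨i, hij, by simp [hia, hx]⟩, inv_one, one_mul]
        simpa using h₂.mul_of_smallCompatible hM h₁
    exact fun f hf => main 0 (Nat.zero_le _) f hf fun x ⟨i, hi, _⟩ => absurd hi (Nat.not_lt_zero _)

lemma compFG_of_normal_eq_bot_or_top [Finite G]
    (h : ∀ N : Subgroup G, N.Normal → N = ⊥ ∨ N = ⊤) : CompFG G := by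
  classical
  have hall : ∀ {n : ℕ} (f : (Fin n → G) → G), Compatible f := by
    intro n f N hN a b hab
    rcases h N hN with rfl | rfl
    · have : a = b := funext fun i => inv_mul_eq_one.mp (hab i)
      simp [this]
    · exact Subgroup.mem_top _
  refine compFG_of_smallCompatible 2 fun n hn => ?_
  induction n, hn using Nat.le_induction with
  | base => exact fun f hf => inClone_smallCompatible_of_le le_rfl one_le_two hf
  | succ n hn ih =>
    intro f _
    have hfin : ∀ T : Set G, T.Finite →
        InClone (smallCompatible G 2) fun x => if x 0 ∈ T then f x else 1 := by
      intro T hT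
      induction T, hT using Set.Finite.induction_on with
      | empty => simpa using inClone_const one_le_two (Nat.le_add_left 1 n) (1 : G)
      | @insert a T ha _ ihT =>
        have h₁ : InClone (smallCompatible G 2) fun x : Fin (n + 1) → G =>
            f (Fin.cons a fun i : Fin n => x i.succ) :=
          .comp (fun y : Fin n → G => f (Fin.cons a y)) (fun i x => x i.succ)
            (ih _ (hall _)) fun i => .proj _
        have h₂ := (inClone_smallCompatible_of_le one_le_two le_rfl
          (hall fun z : Fin 2 → G => if z 0 = a then z 1 else 1)).comp_two (.proj 0) h₁
        convert h₂.mul_of_smallCompatible le_rfl ihT using 2 with x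
        by_cases hx : x 0 = a
        · have hcons : (Fin.cons a fun i : Fin n => x i.succ : Fin (n + 1) → G) = x := by
            rw [← hx]; exact Fin.cons_self_tail x
          simp [hx, ha, hcons]
        · simp [hx]
    simpa using hfin Set.univ Set.finite_univ

end FiniteGeneration

section LowDegree

variable {R α Q Q' : Type*} [CommRing R] {n : ℕ}

/-- The `n`-ary `R`-valued functions of degree at most `W`: the span of the functions that depend
on at most `W` of their arguments. -/
def lowDegree (R α : Type*) [CommRing R] (n W : ℕ) : Submodule R ((Fin n → α) → R) :=
  Submodule.span R {ψ | ∃ S : Finset (Fin n), S.card ≤ W ∧ DependsOn ψ (S : Set (Fin n))}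

lemma lowDegree_mono {W W' : ℕ} (h : W ≤ W') : lowDegree R α n W ≤ lowDegree R α n W' :=
  Submodule.span_mono fun _ ⟨S, hS, hψ⟩ => ⟨S, hS.trans h, hψ⟩

lemma const_mem_lowDegree (W : ℕ) (c : R) : (fun _ => c) ∈ lowDegree R α n W :=
  Submodule.subset_span ⟨∅, by simp, fun _ _ _ => rfl⟩

lemma apply_mem_lowDegree_one (φ : α → R) (i : Fin n) :
    (fun x => φ (x i)) ∈ lowDegree R α n 1 :=
  Submodule.subset_span ⟨{i}, by simp, fun x y h => by simp [h i (by simp)]⟩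

lemma mul_mem_lowDegree {W W' : ℕ} {φ ψ : (Fin n → α) → R} (hφ : φ ∈ lowDegree R α n W)
    (hψ : ψ ∈ lowDegree R α n W') : φ * ψ ∈ lowDegree R α n (W + W') := by
  classical
  have h := Submodule.mul_mem_mul hφ hψ
  rw [lowDegree, lowDegree, Submodule.span_mul_span] at h
  refine Submodule.span_mono ?_ h
  rintro _ ⟨φ, ⟨S, hS, hφ⟩, ψ, ⟨T, hT, hψ⟩, rfl⟩
  refine ⟨S ∪ T, (Finset.card_union_le S T).trans (add_le_add hS hT), fun x y hxy => ?_⟩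
  simp only [Pi.mul_apply]
  rw [hφ fun i hi => hxy i (by simp_all), hψ fun i hi => hxy i (by simp_all)]

lemma prod_mem_lowDegree {ι : Type*} {W : ℕ} {φ : ι → (Fin n → α) → R} (s : Finset ι)
    (hφ : ∀ i ∈ s, φ i ∈ lowDegree R α n W) : ∏ i ∈ s, φ i ∈ lowDegree R α n (s.card * W) := by
  classical
  induction s using Finset.induction_on with
  | empty => exact const_mem_lowDegree _ 1
  | insert i s hi ih =>
    rw [Finset.prod_insert hi, Finset.card_insert_of_notMem hi, add_mul, one_mul, add_comm]
    exact mul_mem_lowDegree (hφ i (by simp)) (ih fun j hj => hφ j (by simp [hj]))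

lemma comp_mem_lowDegree [Finite Q] [DecidableEq Q] {m W : ℕ} {q : Fin m → (Fin n → α) → Q}
    (hq : ∀ l a, (fun x => if q l x = a then 1 else 0) ∈ lowDegree R α n W)
    (H : (Fin m → Q) → R) : (fun x => H fun l => q l x) ∈ lowDegree R α n (m * W) := by
  have := Fintype.ofFinite Q
  have h : (fun x => H fun l => q l x) = ∑ a : Fin m → Q, H a •
      ∏ l, fun x => if q l x = a l then (1 : R) else 0 := by
    funext x
    rw [Finset.sum_apply, Finset.sum_eq_single fun l => q l x]
    · simp
    · intro a _ ha
      obtain ⟨l, hl⟩ := Function.ne_iff.mp ha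
      rw [Pi.smul_apply, Finset.prod_apply, Finset.prod_eq_zero (Finset.mem_univ l)
        (if_neg hl.symm), smul_zero]
    · simp
  rw [h]
  refine Submodule.sum_mem _ fun a _ => Submodule.smul_mem _ _ ?_
  simpa using prod_mem_lowDegree Finset.univ fun l _ => hq l (a l)

lemma comp₂_mem_lowDegree [Finite Q] [Finite Q'] [DecidableEq Q] [DecidableEq Q'] {W W' : ℕ}
    {q : (Fin n → α) → Q}
    {q' : (Fin n → α) → Q'}
    (hq : ∀ a, (fun x => if q x = a then 1 else 0) ∈ lowDegree R α n W)
    (hq' : ∀ a, (fun x => if q' x = a then 1 else 0) ∈ lowDegree R α n W')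
    (H : Q × Q' → R) : (fun x => H (q x, q' x)) ∈ lowDegree R α n (W + W') := by
  have := Fintype.ofFinite Q
  have := Fintype.ofFinite Q'
  have h : (fun x => H (q x, q' x)) = ∑ a : Q × Q', H a •
      ((fun x => if q x = a.1 then (1 : R) else 0) * fun x => if q' x = a.2 then 1 else 0) := by
    funext x
    rw [Finset.sum_apply, Finset.sum_eq_single (q x, q' x)]
    · simp
    · rintro ⟨a, b⟩ - hab
      rw [ne_eq, Prod.mk.injEq, not_and_or] at hab
      rcases hab with h | h <;> simp [Ne.symm h]
    · simp
  rw [h]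
  exact Submodule.sum_mem _ fun a _ => Submodule.smul_mem _ _ (mul_mem_lowDegree (hq _) (hq' _))

lemma indicator_mem_lowDegree {p : ℕ} [Fact p.Prime] {W : ℕ} {c : (Fin n → α) → ZMod p}
    (hc : c ∈ lowDegree (ZMod p) α n W) (s : ZMod p) :
    (fun x => if c x = s then 1 else 0) ∈ lowDegree (ZMod p) α n ((p - 1) * W) := by
  have h : (fun x => if c x = s then (1 : ZMod p) else 0) =
      (fun _ => 1) - ∏ _i ∈ Finset.range (p - 1), (c - fun _ => s) := by
    funext x
    have hp : p - 1 ≠ 0 := (Nat.sub_pos_of_lt (Fact.out : p.Prime).one_lt).ne'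
    by_cases hx : c x = s
    · simp [hx, hp]
    · simp [hx, ZMod.pow_card_sub_one_eq_one (sub_ne_zero.mpr hx)]
  rw [h]
  refine Submodule.sub_mem _ (const_mem_lowDegree _ _) ?_
  simpa using prod_mem_lowDegree (Finset.range (p - 1))
    fun _ _ => Submodule.sub_mem _ hc (const_mem_lowDegree _ s)

/-- The indicator function of a box `∏ T` of full dimension has full degree. -/
lemma indicator_notMem_lowDegree [Nontrivial R] {W : ℕ} (hW : W < n) {T : Set α} {u v : α}
    (hu : u ∈ T) (hv : v ∉ T) {φ : (Fin n → α) → R} (h₁ : ∀ x, (∀ i, x i ∈ T) → φ x = 1)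
    (h₀ : ∀ x, (∃ i, x i ∉ T) → φ x = 0) : φ ∉ lowDegree R α n W := by
  let Λ : ((Fin n → α) → R) → R := fun ψ =>
    ∑ b : Fin n → Bool, (∏ i, if b i then 1 else -1) * ψ fun i => if b i then u else v
  have hΛφ : Λ φ = 1 := by
    simp only [Λ]
    rw [Finset.sum_eq_single fun _ => true]
    · simp [h₁ (fun _ => u) fun _ => hu]
    · intro b _ hb
      obtain ⟨i, hi⟩ := Function.ne_iff.mp hb
      rw [h₀ _ ⟨i, by simpa [hi] using hv⟩, mul_zero]
    · simp
  intro hφ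
  have hΛ : Λ φ = 0 := by
    refine Submodule.span_induction (p := fun ψ _ => Λ ψ = 0) ?_ ?_ ?_ ?_ hφ
    · rintro ψ ⟨S, hS, hψ⟩
      obtain ⟨j, -, hj⟩ := Finset.exists_mem_notMem_of_card_lt_card
        (s := S) (t := Finset.univ) (by simpa using hS.trans_lt hW)
      refine Finset.sum_involution (fun b _ => Function.update b j (!b j)) ?_ ?_ ?_ ?_
      · intro b _
        have hval : (ψ fun i => if Function.update b j (!b j) i then u else v) =
            ψ fun i => if b i then u else v := hψ fun i hi => by
          have : i ≠ j := fun h => hj (h ▸ hi)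
          simp [this]
        rw [hval, ← add_mul, ← Finset.mul_prod_erase _ _ (Finset.mem_univ j),
          ← Finset.mul_prod_erase Finset.univ _ (Finset.mem_univ j)]
        have hprod : ∏ i ∈ Finset.univ.erase j,
            (if Function.update b j (!b j) i then (1 : R) else -1) =
            ∏ i ∈ Finset.univ.erase j, if b i then 1 else -1 :=
          Finset.prod_congr rfl fun i hi => by simp [Finset.ne_of_mem_erase hi]
        rw [hprod, ← add_mul]
        cases h : b j <;> simp
      · intro b _ _ h
        have := congrFun h j
        simp at this
      · simp
      · simp
    · simp [Λ]
    · intro φ ψ _ _ hφ hψ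
      simp only [Λ, Pi.add_apply, mul_add, Finset.sum_add_distrib] at hφ hψ ⊢
      rw [hφ, hψ, add_zero]
    · intro c ψ _ hψ
      simp only [Λ, Pi.smul_apply, smul_eq_mul, mul_left_comm _ c, ← Finset.mul_sum] at hψ ⊢
      rw [hψ, mul_zero]
  exact one_ne_zero (hΛφ.symm.trans hΛ)

end LowDegree

lemma InClone.comp_induction {A : Type*} {F : Set (FinOp A)} {n : ℕ}
    {Q : ((Fin n → A) → A) → Prop}
    (hQ : ∀ t ∈ F, ∀ g : Fin t.1 → (Fin n → A) → A, (∀ i, Q (g i)) →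
      Q fun x => t.2 fun i => g i x)
    {m : ℕ} {f : (Fin m → A) → A} (hf : InClone F f) (g : Fin m → (Fin n → A) → A)
    (hg : ∀ i, Q (g i)) : Q fun x => f fun i => g i x := by
  induction hf with
  | proj i => exact hg i
  | base f h => exact hQ _ h g hg
  | comp f h _ _ ihf ihh => exact ihf _ fun i => ihh i g hg

section DegreeBound

variable {G : Type*} [Group G] {p : ℕ}

/-- A character of `B` is determined up to a scalar by its kernel, if that has index `p`. -/
lemma eq_mul_of_additive [Fact p.Prime] {A B : Subgroup G} {χ ψ : G → ZMod p}
    (hχ : ∀ x ∈ B, ∀ y ∈ B, χ (x * y) = χ x + χ y) (hker : ∀ x ∈ B, χ x = 0 → x ∈ A)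
    (hψ : ∀ x ∈ B, ∀ y ∈ B, ψ (x * y) = ψ x + ψ y) (hkerψ : ∀ x ∈ A, ψ x = 0)
    {b : G} (hb : b ∈ B) (hb1 : χ b = 1) {x : G} (hx : x ∈ B) : ψ x = ψ b * χ x := by
  have hpow := B.pow_mem hb (χ x).val
  have hd : x * (b ^ (χ x).val)⁻¹ ∈ B := B.mul_mem hx (B.inv_mem hpow)
  have hdA : x * (b ^ (χ x).val)⁻¹ ∈ A := hker _ hd <| by
    have := hχ _ hd _ hpow
    rw [inv_mul_cancel_right, apply_pow_of_additive hχ hb, hb1, mul_one,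
      ZMod.natCast_zmod_val] at this
    simpa using this
  have := hψ _ hd _ hpow
  rw [inv_mul_cancel_right, hkerψ _ hdA, apply_pow_of_additive hψ hb, ZMod.natCast_zmod_val,
    zero_add, mul_comm] at this
  exact this

/-- The perturbation of a compatible function by elements of `B` is linear modulo `A`. -/
lemma CentralFactor.exists_linear [Fact p.Prime] {A B : Subgroup G} (hAn : A.Normal)
    (hBn : B.Normal) (hAB : A ≤ B)
    (hcf : CentralFactor A B) {χ : G → ZMod p} (hχ : ∀ x ∈ B, ∀ y ∈ B, χ (x * y) = χ x + χ y)
    (hker : ∀ x ∈ B, χ x = 0 ↔ x ∈ A) {b : G} (hb : b ∈ B) (hb1 : χ b = 1)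
    {m : ℕ} {t : (Fin m → G) → G} (ht : Compatible t) :
    ∃ a : Fin m → ZMod p, ∀ x u : Fin m → G, (∀ i, u i ∈ B) →
      χ ((t x)⁻¹ * t (x * u)) = ∑ i, a i * χ (u i) := by
  have hmem : ∀ x u : Fin m → G, (∀ i, u i ∈ B) → (t x)⁻¹ * t (x * u) ∈ B := fun x u hu =>
    ht B hBn _ _ fun i => by simpa using hu i
  let L : (Fin m → G) → ZMod p := fun u => χ ((t 1)⁻¹ * t u)
  have hL : ∀ x u : Fin m → G, (∀ i, u i ∈ B) → χ ((t x)⁻¹ * t (x * u)) = L u := by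
    intro x u hu
    have h1 : (t 1)⁻¹ * t u ∈ B := by simpa using hmem 1 u hu
    have hA := hcf t ht x u hu
    have := hχ _ (hAB hA) _ h1
    rwa [inv_mul_cancel_right, (hker _ (hAB hA)).mpr hA, zero_add] at this
  have hLadd : ∀ u v : Fin m → G, (∀ i, u i ∈ B) → (∀ i, v i ∈ B) → L (u * v) = L u + L v := by
    intro u v hu hv
    have h1 : (t 1)⁻¹ * t u ∈ B := by simpa using hmem 1 u hu
    rw [← hL u v hv, ← hχ _ h1 _ (hmem u v hv)]
    simp [L, mul_assoc]
  have hsingle : ∀ i, ∀ y ∈ B, ∀ j, (Pi.mulSingle i y : Fin m → G) j ∈ B := by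
    intro i y hy j
    rcases eq_or_ne j i with rfl | hj
    · simpa using hy
    · simp [hj, B.one_mem]
  have hLA : ∀ i, ∀ y ∈ A, L (Pi.mulSingle i y) = 0 := by
    intro i y hy
    have h : (t 1)⁻¹ * t (Pi.mulSingle i y) ∈ A := ht A hAn _ _ fun j => by
      rcases eq_or_ne j i with rfl | hj
      · simpa using hy
      · simp [hj, A.one_mem]
    exact (hker _ (hAB h)).mpr h
  refine ⟨fun i => L (Pi.mulSingle i b), fun x u hu => ?_⟩
  have hLsingle : ∀ i, L (Pi.mulSingle i (u i)) = L (Pi.mulSingle i b) * χ (u i) := fun i =>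
    eq_mul_of_additive (ψ := fun y => L (Pi.mulSingle i y)) hχ (fun y hy => (hker y hy).mp)
      (fun y hy z hz => by
        rw [Pi.mulSingle_mul]
        exact hLadd _ _ (hsingle i y hy) (hsingle i z hz)) (hLA i) hb hb1 (hu i)
  have hsum : ∀ s : Finset (Fin m), L (fun i => if i ∈ s then u i else 1) =
      ∑ i ∈ s, L (Pi.mulSingle i (u i)) := by
    intro s
    induction s using Finset.induction_on with
    | empty =>
      have h0 := hLadd 1 1 (fun _ => B.one_mem) fun _ => B.one_mem
      rw [one_mul, left_eq_add] at h0
      simpa [Pi.one_def] using h0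
    | insert i s hi ih =>
      rw [Finset.sum_insert hi, ← ih, ← hLadd _ _ (hsingle i _ (hu i)) fun j => by
        split_ifs
        exacts [hu j, B.one_mem]]
      congr 1
      funext j
      rcases eq_or_ne j i with rfl | hj
      · simp [hi]
      · simp [hj]
  rw [hL x u hu, ← Finset.sum_congr rfl fun i _ => hLsingle i, ← hsum]
  simp

/-- The `G / A`-valued parts of the functions in the clone generated by `F` have bounded degree. -/
def BoundedDegree (p : ℕ) (F : Set (FinOp G)) (A : Subgroup G) : Prop :=
  ∃ W : ℕ, ∀ {n : ℕ} (f : (Fin n → G) → G), InClone F f → ∀ φ : G ⧸ A → ZMod p,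
    (fun x => φ (f x)) ∈ lowDegree (ZMod p) G n W

lemma boundedDegree_top (p : ℕ) (F : Set (FinOp G)) : BoundedDegree p F (⊤ : Subgroup G) := by
  refine ⟨0, fun f _ φ => ?_⟩
  have h : ∀ x, φ (f x) = φ ((1 : G) : G ⧸ (⊤ : Subgroup G)) := fun x =>
    congrArg φ (QuotientGroup.eq.mpr (Subgroup.mem_top _))
  simp only [h]
  exact const_mem_lowDegree 0 _

open Classical in
lemma BoundedDegree.of_normalStep [Finite G] (hp : p.Prime) (hG : IsPGroup p G)
    {F : Set (FinOp G)} (hF : ∀ f ∈ F, Compatible f.2) {M : ℕ} (hM : ∀ f ∈ F, f.1 ≤ M)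
    {A B : Subgroup G} (h : NormalStep p A B) (hcf : CentralFactor A B)
    (hB : BoundedDegree p F B) : BoundedDegree p F A := by
  have : Fact p.Prime := ⟨hp⟩
  obtain ⟨W, hW⟩ := hB
  obtain ⟨χ, hχ, hker, -⟩ := h.exists_char hp hG
  obtain ⟨a, ha, haA⟩ := SetLike.exists_of_lt (h.lt hp)
  obtain ⟨b, hb, hb1⟩ := exists_mem_apply_eq hp le_rfl hχ ha (fun h0 => haA ((hker a ha).mp h0)) 1
  let r : G → G := fun x => Quotient.out (x : G ⧸ B)
  have hr : ∀ x, (r x : G ⧸ B) = x := fun x => Quotient.out_eq' _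
  have hrB : ∀ x, (r x)⁻¹ * x ∈ B := fun x => QuotientGroup.eq.mp (hr x)
  let c : G → ZMod p := fun x => χ ((r x)⁻¹ * x)
  have hstep : ∀ {m : ℕ} {t : (Fin m → G) → G}, Compatible t → ∃ a : Fin m → ZMod p, ∀ x,
      c (t x) = c (t fun i => r (x i)) + ∑ i, a i * c (x i) := by
    intro m t ht
    obtain ⟨a, hlin⟩ := hcf.exists_linear h.normal_left h.normal_right h.le hχ hker hb hb1 ht
    refine ⟨a, fun x => ?_⟩
    have hx : (fun i => r (x i)) * (fun i => (r (x i))⁻¹ * x i) = x := by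
      funext i
      simp
    have hlin := hlin (fun i => r (x i)) (fun i => (r (x i))⁻¹ * x i) fun i => hrB _
    rw [hx] at hlin
    have hmk : ((t fun i => r (x i) : G) : G ⧸ B) = t x := ht.mk_eq h.normal_right fun i => hr _
    have hrt : r (t fun i => r (x i)) = r (t x) := congrArg Quotient.out hmk
    rw [← hlin, ← hχ _ (hrB _) _ (QuotientGroup.eq.mp hmk), hrt]
    simp [c, mul_assoc]
  have hcdeg : ∀ {n : ℕ} (f : (Fin n → G) → G), InClone F f →
      (fun x => c (f x)) ∈ lowDegree (ZMod p) G n (max (M * W) 1) := by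
    intro n f hf
    refine (InClone.comp_induction (Q := fun g => InClone F g ∧
      (fun x => c (g x)) ∈ lowDegree (ZMod p) G n (max (M * W) 1)) ?_ hf (fun i x => x i)
      fun i => ⟨.proj i, lowDegree_mono (le_max_right _ _) (apply_mem_lowDegree_one c i)⟩).2
    rintro ⟨m, t⟩ ht g hg
    refine ⟨.comp t g (.base t ht) fun i => (hg i).1, ?_⟩
    obtain ⟨a, hct⟩ := hstep (hF _ ht)
    have heq : (fun x => c (t fun i => g i x)) =
        (fun x => c (t fun i => r (g i x))) + ∑ i, a i • fun x => c (g i x) := by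
      funext x
      simpa using hct fun i => g i x
    rw [heq]
    refine Submodule.add_mem _ ?_ (Submodule.sum_mem _ fun i _ => Submodule.smul_mem _ _ (hg i).2)
    refine lowDegree_mono (le_max_of_le_left (Nat.mul_le_mul_right W (hM _ ht))) ?_
    exact comp_mem_lowDegree (q := fun i x => (g i x : G ⧸ B))
      (fun i q => hW (g i) (hg i).1 fun z => if z = q then 1 else 0)
      fun z => c (t fun i => Quotient.out (z i))
  refine ⟨W + (p - 1) * max (M * W) 1, fun {n} f hf φ => ?_⟩
  have hfac : Function.FactorsThrough (fun x : G => φ x) fun x => ((x : G ⧸ B), c x) := by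
    intro x y hxy
    obtain ⟨hq, hc⟩ := Prod.mk.inj hxy
    refine congrArg φ (QuotientGroup.eq.mpr ((hker _ (QuotientGroup.eq.mp hq)).mp ?_))
    have hrxy : r x = r y := congrArg Quotient.out hq
    have hadd := hχ _ (hrB x) _ (QuotientGroup.eq.mp hq)
    rw [mul_assoc, mul_inv_cancel_left, hrxy] at hadd
    have hc' : χ ((r x)⁻¹ * x) = χ ((r y)⁻¹ * y) := hc
    rw [hrxy] at hc'
    rw [hc'] at hadd
    simpa using hadd
  have := comp₂_mem_lowDegree (q := fun x => (f x : G ⧸ B)) (q' := fun x => c (f x))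
    (fun q => hW f hf fun z => if z = q then 1 else 0)
    (fun s => indicator_mem_lowDegree (hcdeg f hf) s)
    (Function.extend (fun x : G => ((x : G ⧸ B), c x)) (fun x => φ x) 0)
  simpa only [hfac.extend_apply] using this

lemma boundedDegree [Finite G] (hp : p.Prime) (hG : IsPGroup p G) (hcyc : ¬ IsCyclic G)
    (honly : ∀ N : Subgroup G, N.Normal →
      (∀ M : Subgroup G, M.Normal → M ≤ N ∨ N ≤ M) → N = ⊥ ∨ N = ⊤)
    {F : Set (FinOp G)} (hfin : F.Finite) (hF : ∀ f ∈ F, Compatible f.2)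
    (A : Subgroup G) (hA : A.Normal) : BoundedDegree p F A := by
  obtain ⟨M, hM⟩ := (hfin.image Sigma.fst).bddAbove
  induction A using WellFoundedGT.induction with
  | ind A ih =>
    rcases eq_or_ne A ⊤ with rfl | hAtop
    · exact boundedDegree_top p F
    · obtain ⟨B, -, hstep, -⟩ :=
        hG.exists_normalStep_central hp hA inferInstance (lt_top_iff_ne_top.mpr hAtop)
      exact (ih B (hstep.lt hp) hstep.normal_right).of_normalStep hp hG hF
        (fun f hf => hM ⟨f, hf, rfl⟩) hstep (hstep.centralFactor hp hG hcyc honly)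

end DegreeBound

section Splitting

variable {G : Type*} [Group G]

open Classical in
lemma compatible_box {E D : Subgroup G} (hD : D.Normal)
    (h : ∀ I : Subgroup G, I.Normal → E ≤ I ∨ I ≤ D) {e : G} (he : e ∈ E) (k : ℕ) :
    Compatible fun x : Fin k → G => if ∀ i, x i ∉ D then e else 1 := by
  intro I hI x y hxy
  rcases h I hI with hEI | hID
  · have hmem : ∀ x : Fin k → G, (if ∀ i, x i ∉ D then e else 1) ∈ I := fun x => by
      split_ifs
      exacts [hEI he, I.one_mem]
    exact I.mul_mem (I.inv_mem (hmem x)) (hmem y)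
  · have hiff : ∀ i, x i ∉ D ↔ y i ∉ D := fun i => by
      rw [← QuotientGroup.eq_one_iff, ← QuotientGroup.eq_one_iff,
        QuotientGroup.eq.mpr (hID (hxy i))]
    simp only [hiff, inv_mul_cancel, I.one_mem]

lemma not_compFG_of_splitting [Finite G] {p : ℕ} (hp : p.Prime) (hG : IsPGroup p G)
    (hcyc : ¬ IsCyclic G)
    (honly : ∀ N : Subgroup G, N.Normal →
      (∀ M : Subgroup G, M.Normal → M ≤ N ∨ N ≤ M) → N = ⊥ ∨ N = ⊤)
    {E D : Subgroup G} (hD : D.Normal) (hE1 : E ≠ ⊥) (hD1 : D ≠ ⊤)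
    (h : ∀ I : Subgroup G, I.Normal → E ≤ I ∨ I ≤ D) : ¬ CompFG G := by
  classical
  have : Fact p.Prime := ⟨hp⟩
  rintro ⟨F, hfin, hF, hgen⟩
  obtain ⟨W, hW⟩ := boundedDegree hp hG hcyc honly hfin (fun f hf => (hF f hf).2) ⊥ inferInstance
  obtain ⟨e, he, he1⟩ := E.bot_or_exists_ne_one.resolve_left hE1
  obtain ⟨u, -, hu⟩ := SetLike.exists_of_lt (lt_top_iff_ne_top.mpr hD1)
  have hf := (hgen (W + 1) (by omega) _).mp (compatible_box hD h he (W + 1))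
  refine indicator_notMem_lowDegree (lt_add_one W) (T := {x | x ∉ D}) (u := u) (v := 1) hu
    (fun h => h D.one_mem) ?_ ?_
    (hW _ hf fun z => if z = ((e : G) : G ⧸ (⊥ : Subgroup G)) then 1 else 0)
  · intro x hx
    have hx : ∀ i, x i ∉ D := hx
    simp [hx]
  · rintro x ⟨i, hi⟩
    have hx : ¬ ∀ i, x i ∉ D := fun h => hi (h i)
    rw [if_neg hx, if_neg]
    rw [eq_comm, QuotientGroup.mk_one, QuotientGroup.eq_one_iff, Subgroup.mem_bot]
    exact he1

lemma IsCyclic.subgroup_le_total [Finite G] [IsCyclic G] {p : ℕ} (hp : p.Prime)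
    (hG : IsPGroup p G) (H K : Subgroup G) : H ≤ K ∨ K ≤ H := by
  classical
  have : Fact p.Prime := ⟨hp⟩
  have := Fintype.ofFinite G
  have key : ∀ H K : Subgroup G, Nat.card H ∣ Nat.card K → H ≤ K := by
    intro H K hdvd
    let T : Finset G := Finset.univ.filter fun x => x ^ Nat.card K = 1
    have hKT : (K : Set G).toFinset = T :=
      Finset.eq_of_subset_of_card_le
        (fun x hx => by
          simpa [T] using orderOf_dvd_iff_pow_eq_one.mp
            (Subgroup.orderOf_dvd_natCard K (by simpa using hx)))
        ((IsCyclic.card_pow_eq_one_le Nat.card_pos).trans_eq (by simp))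
    intro x hx
    have hxT : x ∈ T := by
      simpa [T] using orderOf_dvd_iff_pow_eq_one.mp
        ((Subgroup.orderOf_dvd_natCard H hx).trans hdvd)
    simpa [← hKT] using hxT
  obtain ⟨a, ha⟩ := IsPGroup.iff_card.mp (hG.to_subgroup H)
  obtain ⟨b, hb⟩ := IsPGroup.iff_card.mp (hG.to_subgroup K)
  rcases le_total a b with hab | hab
  · exact .inl (key H K (ha ▸ hb ▸ pow_dvd_pow p hab))
  · exact .inr (key K H (ha ▸ hb ▸ pow_dvd_pow p hab))

end Splitting

/-- Theorem 1.3 of the paper: for a finite `p`-group `G` in which `⊥` and `⊤`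
are the only normal subgroups comparable to all other normal subgroups,
`Comp G` is not finitely generated iff `G` is not cyclic and the normal
subgroup lattice has a splitting pair `(D, E)`. -/
theorem compFG_not_iff_of_pGroup (p : ℕ) (hp : p.Prime) (G : Type*) [Group G] [Finite G]
    (hpG : IsPGroup p G)
    (honly : ∀ N : Subgroup G, N.Normal →
      (∀ M : Subgroup G, M.Normal → M ≤ N ∨ N ≤ M) → N = ⊥ ∨ N = ⊤) :
    ¬ CompFG G ↔
      (¬ IsCyclic G ∧ ∃ E D : Subgroup G, E.Normal ∧ D.Normal ∧ E ≠ ⊥ ∧ D ≠ ⊤ ∧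
        ∀ I : Subgroup G, I.Normal → E ≤ I ∨ I ≤ D) := by
  constructor
  · intro hfg
    refine ⟨fun hcyc => hfg (compFG_of_normal_eq_bot_or_top fun N hN => honly N hN fun M _ =>
      IsCyclic.subgroup_le_total hp hpG M N), ?_⟩
    by_contra hsplit
    obtain ⟨K, hK⟩ := exists_arity_absorbing_trivial hsplit
    exact hfg (compFG_of_absorbing_trivial K hK)
  · rintro ⟨hcyc, E, D, -, hD, hE1, hD1, h⟩
    exact not_compFG_of_splitting hp hpG hcyc honly hD hE1 hD1 h
end

section
/- Let G be a finite nilpotent group. The clone Comp(G) of congruence preserving functions of G is finitely generated if and only if for every Sylow subgroup P of G, the clone Comp(P) of congruence preserving functions of P is finitely generated. -/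
section CompatibleRetract

variable {G H : Type*} [Group G] [Group H]

theorem InClone.compatible {F : Set (FinOp G)} (hF : ∀ f ∈ F, Compatible f.2) {n : ℕ}
    {f : (Fin n → G) → G} (hf : InClone F f) : Compatible f := by
  induction hf with
  | proj i => exact fun N _ a b hab => hab i
  | base f h => exact hF _ h
  | comp f g _ _ ihf ihg => exact fun N hN a b hab => ihf N hN _ _ fun i => ihg i N hN a b hab

/-- A finite set of compatible functions of positive arity witnesses `CompFG` as soon as every
compatible function of positive arity lies in the clone it generates. -/
theorem CompFG.of_forall_inClone {F : Set (FinOp G)} (hfin : F.Finite)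
    (hF : ∀ f ∈ F, 1 ≤ f.1 ∧ Compatible f.2)
    (h : ∀ n : ℕ, 1 ≤ n → ∀ f : (Fin n → G) → G, Compatible f → InClone F f) : CompFG G :=
  ⟨F, hfin, hF, fun n hn f => ⟨h n hn f, InClone.compatible fun f hf => (hF f hf).2⟩⟩

theorem CompFG.of_subsingleton [Subsingleton G] : CompFG G :=
  .of_forall_inClone Set.finite_empty (by simp) fun n hn f _ => by
    have hf : f = fun x => x ⟨0, hn⟩ := funext fun x => Subsingleton.elim _ _
    exact hf ▸ .proj _

theorem compatible_one {n : ℕ} : Compatible fun _ : Fin n → G => (1 : G) :=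
  fun N _ _ _ _ => by simp

theorem compatible_mul : Compatible fun x : Fin 2 → G => x 0 * x 1 := by
  intro N hN a b hab
  simp only [← QuotientGroup.eq, QuotientGroup.mk_mul] at hab ⊢
  rw [hab 0, hab 1]

/-- A retraction `π : G → H` with section `ι` such that the induced endomorphism of `G` preserves
every normal subgroup. -/
structure IsCompatibleRetract (ι : H →* G) (π : G →* H) : Prop where
  leftInverse (x : H) : π (ι x) = x
  mem (N : Subgroup G) : N.Normal → ∀ x ∈ N, ι (π x) ∈ N

/-- The operation on `G` induced by an operation on `H` through `ι : H → G` and `π : G → H`. -/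
def FinOp.conj (ι : H →* G) (π : G →* H) (f : FinOp H) : FinOp G :=
  ⟨f.1, fun x => ι (f.2 fun k => π (x k))⟩

namespace IsCompatibleRetract

variable {ι : H →* G} {π : G →* H} {n : ℕ}

theorem compatible_lift (h : IsCompatibleRetract ι π) {f : (Fin n → H) → H} (hf : Compatible f) :
    Compatible fun x : Fin n → G => ι (f fun k => π (x k)) := by
  intro N hN a b hab
  have := hf (N.comap ι) (hN.comap ι) (fun k => π (a k)) (fun k => π (b k)) fun k => by
    simpa using h.mem N hN _ (hab k)
  simpa using this

theorem compatible_restrict (h : IsCompatibleRetract ι π) {f : (Fin n → G) → G}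
    (hf : Compatible f) : Compatible fun x : Fin n → H => π (f fun k => ι (x k)) := by
  intro N hN a b hab
  have := hf (N.comap π) (hN.comap π) (fun k => ι (a k)) (fun k => ι (b k)) fun k => by
    simpa [h.leftInverse] using hab k
  simpa using this

theorem apply_eq (h : IsCompatibleRetract ι π) {f : (Fin n → G) → G} (hf : Compatible f)
    (x : Fin n → G) : π (f x) = π (f fun k => ι (π (x k))) := by
  have := hf π.ker inferInstance x (fun k => ι (π (x k))) fun k => by
    simp [MonoidHom.mem_ker, h.leftInverse]
  rwa [MonoidHom.mem_ker, map_mul, map_inv, inv_mul_eq_one] at this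

theorem inClone_restrict (h : IsCompatibleRetract ι π) {F : Set (FinOp G)}
    (hF : ∀ f ∈ F, Compatible f.2) {f : (Fin n → G) → G} (hf : InClone F f) :
    InClone (FinOp.conj π ι '' F) fun x => π (f fun k => ι (x k)) := by
  induction hf with
  | proj i => simpa only [h.leftInverse] using InClone.proj i
  | base f hf => exact .base _ ⟨_, hf, rfl⟩
  | comp f g hf _ ihf ihg =>
    simpa only [← h.apply_eq (hf.compatible hF)] using InClone.comp _ _ ihf ihg

theorem inClone_lift (h : IsCompatibleRetract ι π) {F : Set (FinOp H)} {F' : Set (FinOp G)}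
    (hF : FinOp.conj ι π '' F ⊆ F') (hπ : ⟨1, fun x => ι (π (x 0))⟩ ∈ F')
    {f : (Fin n → H) → H} (hf : InClone F f) :
    InClone F' fun x => ι (f fun k => π (x k)) := by
  induction hf with
  | proj i => exact .comp (m := 1) (fun x => ι (π (x 0))) _ (.base _ hπ) fun _ => .proj i
  | base f hf => exact .base _ (hF ⟨_, hf, rfl⟩)
  | comp f g _ _ ihf ihg => simpa only [h.leftInverse] using InClone.comp _ _ ihf ihg

theorem compFG (h : IsCompatibleRetract ι π) (hG : CompFG G) : CompFG H := by
  obtain ⟨F, hfin, hF, hgen⟩ := hG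
  refine .of_forall_inClone (hfin.image (FinOp.conj π ι)) ?_ fun n hn f hf => ?_
  · rintro _ ⟨f, hf, rfl⟩
    exact ⟨(hF f hf).1, h.compatible_restrict (hF f hf).2⟩
  · simpa only [h.leftInverse] using
      h.inClone_restrict (fun f hf => (hF f hf).2) ((hgen n hn _).1 (h.compatible_lift hf))

end IsCompatibleRetract

theorem InClone.list_prod {F : Set (FinOp G)} (hone : ⟨1, fun _ => 1⟩ ∈ F)
    (hmul : ⟨2, fun x => x 0 * x 1⟩ ∈ F) {n : ℕ} (hn : 1 ≤ n) {ι : Type*}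
    {g : ι → (Fin n → G) → G} (hg : ∀ i, InClone F (g i)) (l : List ι) :
    InClone F fun x => (l.map fun i => g i x).prod := by
  induction l with
  | nil => exact .comp (m := 1) _ _ (.base _ hone) fun _ => .proj ⟨0, hn⟩
  | cons i l ih =>
    simpa using InClone.comp _ ![g i, fun x => (l.map fun i => g i x).prod] (.base _ hmul)
      (Fin.forall_fin_two.2 ⟨hg i, ih⟩)

theorem CompFG.of_isCompatibleRetract {I : Type*} [Finite I] {H : I → Type*} [∀ i, Group (H i)]
    {ι : ∀ i, H i →* G} {π : ∀ i, G →* H i} (h : ∀ i, IsCompatibleRetract (ι i) (π i))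
    (l : List I) (hl : ∀ x, (l.map fun i => ι i (π i x)).prod = x)
    (hH : ∀ i, CompFG (H i)) : CompFG G := by
  choose F hfin hF hgen using hH
  let F' : Set (FinOp G) := {⟨1, fun _ => 1⟩, ⟨2, fun x => x 0 * x 1⟩} ∪
    (Set.range fun i => ⟨1, fun x => ι i (π i (x 0))⟩) ∪ ⋃ i, FinOp.conj (ι i) (π i) '' F i
  refine .of_forall_inClone (F := F') ?_ ?_ fun n hn f hf => ?_
  · exact ((Set.toFinite _).union (Set.finite_range _)).union
      (Set.finite_iUnion fun i => (hfin i).image _)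
  · rintro f (((rfl | rfl) | ⟨i, rfl⟩) | hf)
    · exact ⟨le_rfl, compatible_one⟩
    · exact ⟨one_le_two, compatible_mul⟩
    · exact ⟨le_rfl, (h i).compatible_lift (f := fun x => x 0) fun N _ a b hab => hab 0⟩
    · obtain ⟨i, g, hg, rfl⟩ := Set.mem_iUnion.1 hf
      exact ⟨(hF i g hg).1, (h i).compatible_lift (hF i g hg).2⟩
  · have hlift (i : I) : InClone F' fun x => ι i (π i (f x)) := by
      rw [show (fun x => ι i (π i (f x))) = fun x => ι i (π i (f fun k => ι i (π i (x k)))) from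
        funext fun x => congrArg (ι i) ((h i).apply_eq hf x)]
      exact (h i).inClone_lift
        (fun _ hg => .inr (Set.mem_iUnion.2 ⟨i, hg⟩)) (.inl (.inr ⟨i, rfl⟩))
        ((hgen i n hn _).1 ((h i).compatible_restrict hf))
    simpa only [hl] using
      InClone.list_prod (.inl (.inl (.inl rfl))) (.inl (.inl (.inr rfl))) hn hlift l

end CompatibleRetract

section Pi

variable {G I : Type*} [Group G] [Finite I] [DecidableEq I] {H : I → Type*} [∀ i, Group (H i)]

theorem Pi.exists_pow_eq_mulSingle
    (hco : Pairwise fun i j => (Nat.card (H i)).Coprime (Nat.card (H j)))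
    (i : I) : ∃ k : ℕ, ∀ x : ∀ i, H i, x ^ k = Pi.mulSingle i (x i) := by
  have := Fintype.ofFinite I
  have hco' : (Nat.card (H i)).Coprime (∏ j ∈ Finset.univ.erase i, Nat.card (H j)) :=
    Nat.Coprime.prod_right fun j hj => hco (Finset.ne_of_mem_erase hj).symm
  obtain ⟨k, hk₁, hk₀⟩ := Nat.chineseRemainder hco' 1 0
  refine ⟨k, fun x => funext fun j => ?_⟩
  rcases eq_or_ne j i with rfl | hj
  · simpa using (pow_eq_pow_iff_modEq (x := x j) (n := k) (m := 1)).2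
      (hk₁.of_dvd (orderOf_dvd_natCard _))
  · have : Nat.card (H j) ∣ k :=
      (Finset.dvd_prod_of_mem (fun j => Nat.card (H j)) (by simpa using hj)).trans
        (Nat.modEq_zero_iff_dvd.1 hk₀)
    simpa [hj] using orderOf_dvd_iff_pow_eq_one.1 ((orderOf_dvd_natCard (x j)).trans this)

theorem MulEquiv.isCompatibleRetract_pi
    (hco : Pairwise fun i j => (Nat.card (H i)).Coprime (Nat.card (H j)))
    (e : G ≃* ∀ i, H i) (i : I) :
    IsCompatibleRetract (e.symm.toMonoidHom.comp (MonoidHom.mulSingle H i))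
      ((Pi.evalMonoidHom H i).comp e.toMonoidHom) where
  leftInverse x := by simp
  mem N _ x hx := by
    obtain ⟨k, hk⟩ := Pi.exists_pow_eq_mulSingle hco i
    simpa [← hk] using pow_mem hx k

/-- For a group isomorphic to a product of groups of pairwise coprime orders, `CompFG` can be tested
on the factors. -/
theorem compFG_iff_of_mulEquiv_pi
    (hco : Pairwise fun i j => (Nat.card (H i)).Coprime (Nat.card (H j)))
    (e : G ≃* ∀ i, H i) : CompFG G ↔ ∀ i, CompFG (H i) := by
  have := Fintype.ofFinite I
  refine ⟨fun hG i => (e.isCompatibleRetract_pi hco i).compFG hG,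
    .of_isCompatibleRetract (e.isCompatibleRetract_pi hco) Finset.univ.toList fun x => ?_⟩
  apply e.injective
  have := Finset.noncommProd_toFinset Finset.univ.toList (fun i => Pi.mulSingle i (e x i))
    (fun i _ j _ _ => Pi.mulSingle_apply_commute (e x) i j) Finset.univ.nodup_toList
  simp only [Finset.toList_toFinset, Finset.noncommProd_mulSingle] at this
  simpa [map_list_prod, Function.comp_def] using this.symm

end Pi

/-- Theorem (nilpotent groups): the clone of congruence preserving functions
of a finite nilpotent group is finitely generated iff the clone of congruence
preserving functions of every Sylow subgroup is finitely generated. -/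
theorem compFG_iff_sylow_of_nilpotent (G : Type*) [Group G] [Finite G]
    (hnil : Group.IsNilpotent G) :
    CompFG G ↔ ∀ (p : ℕ), p.Prime → ∀ P : Sylow p G, CompFG ↥(P : Subgroup G) := by
  have hnormal := (Group.isNilpotent_of_finite_tfae (G := G)).out 0 3 |>.1 hnil
  obtain ⟨e⟩ := (Group.isNilpotent_of_finite_tfae (G := G)).out 0 4 |>.1 hnil
  let I := Σ p : (Nat.card G).primeFactors, Sylow p G
  let e' : G ≃* ∀ i : I, i.2 := e.symm.trans
    { (Equiv.piCurry fun (p : (Nat.card G).primeFactors) (P : Sylow p G) => P).symm with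
      map_mul' := fun _ _ => rfl }
  have hco : Pairwise fun i j : I => (Nat.card i.2).Coprime (Nat.card j.2) := by
    rintro ⟨p, P⟩ ⟨q, Q⟩ hne
    have hp : Fact (p : ℕ).Prime := ⟨Nat.prime_of_mem_primeFactors p.2⟩
    have hq : Fact (q : ℕ).Prime := ⟨Nat.prime_of_mem_primeFactors q.2⟩
    refine IsPGroup.coprime_card_of_ne (p₁ := p) (p₂ := q) ?_ _ _ P.isPGroup' Q.isPGroup'
    rintro hpq
    obtain rfl := Subtype.ext hpq
    have := P.unique_of_normal (hnormal p hp P)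
    exact hne (congrArg _ (Subsingleton.elim P Q))
  classical
  rw [compFG_iff_of_mulEquiv_pi hco e']
  refine ⟨fun h p hp P => ?_, fun h i => h _ (Nat.prime_of_mem_primeFactors i.1.2) i.2⟩
  by_cases hpG : p ∣ Nat.card G
  · exact h ⟨⟨p, Nat.mem_primeFactors.2 ⟨hp, hpG, Nat.card_pos.ne'⟩⟩, P⟩
  · have : Fact p.Prime := ⟨hp⟩
    have hP : Nat.card P = 1 := by
      rw [P.card_eq_multiplicity, Nat.factorization_eq_zero_of_not_dvd hpG, pow_zero]
    have : Subsingleton P := (Nat.card_eq_one_iff_unique.1 hP).1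
    exact .of_subsingleton
end
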